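/- Under the logarithmic coordinates setup, there exist constants D > 0 and R₁ > 0 such that for every R ≥ R₁ and all u, s ∈ ℤ, with Q = [R/2, 3R/2] × [−R/2, R/2] ⊆ ℂ (the square of side R centered at R), one has diam(g_s(Q)) < D and diam(g_u(g_s(Q))) < D. (Note g_s(Q) ⊆ closure(L_s) ⊆ closure(H), so the composition g_u ∘ g_s is defined on Q.) -/

import Mathlib

open Filter Topology

theorem bloch_aux (g : ℂ → ℂ) (c : ℝ)
    (hg : DifferentiableOn ℂ g {z : ℂ | c < z.re})
    (hd : ∀ z w : ℂ, c < z.re → c < w.re → g w ≠ g z + 2 * Real.pi * Complex.I)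
    (z : ℂ) (hz : c < z.re) : ‖deriv g z‖ * (z.re - c) ≤ 256 * Real.pi := by
  have hHo : IsOpen {z : ℂ | c < z.re} := isOpen_lt continuous_const Complex.continuous_re
  have hg' : DifferentiableOn ℂ (deriv g) {z : ℂ | c < z.re} := hg.deriv hHo
  have hpi := Real.pi_pos
  set r := (z.re - c) / 2 with hr
  have hr0 : 0 < r := by rw [hr]; linarith
  have hsub : ∀ w : ℂ, dist w z ≤ r → c < w.re := by
    intro w hw
    have h1 := Complex.abs_re_le_norm (w - z)
    rw [Complex.dist_eq] at hw
    have h2 := (abs_le.1 (h1.trans hw)).1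
    rw [Complex.sub_re] at h2
    linarith
  rcases eq_or_ne (deriv g z) 0 with h0 | h0
  · rw [h0]; simp; positivity
  have hcont : ContinuousOn (fun w => ‖deriv g w‖ * (r - dist w z)) (Metric.closedBall z r) := by
    have : ContinuousOn (deriv g) (Metric.closedBall z r) :=
      hg'.continuousOn.mono (fun w hw => hsub w hw)
    fun_prop
  obtain ⟨w0, hw0, hmax⟩ := (isCompact_closedBall z r).exists_isMaxOn
    ⟨z, Metric.mem_closedBall_self hr0.le⟩ hcont
  have hmax' : ∀ w, dist w z ≤ r →
      ‖deriv g w‖ * (r - dist w z) ≤ ‖deriv g w0‖ * (r - dist w0 z) := fun w hw => hmax hw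
  have hz0 := hmax' z (by simp [hr0.le])
  rw [dist_self, sub_zero] at hz0
  have hnp : 0 < ‖deriv g z‖ := norm_pos_iff.2 h0
  have hp : 0 < ‖deriv g w0‖ * (r - dist w0 z) := lt_of_lt_of_le (by positivity) hz0
  set A := ‖deriv g w0‖ with hA
  set t := (r - dist w0 z) / 2 with ht
  have hA0 : 0 < A := pos_of_mul_pos_left hp (by have := Metric.mem_closedBall.1 hw0; linarith)
  have ht0 : 0 < t := by
    have := pos_of_mul_pos_right hp hA0.le
    rw [ht]; linarith
  have hball : ∀ w, dist w w0 < t → dist w z ≤ r - t := by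
    intro w hw
    have := dist_triangle w w0 z
    linarith
  have hbd : ∀ w, dist w w0 < t → ‖deriv g w‖ ≤ 2 * A := by
    intro w hw
    have h1 := hball w hw
    have h2 := hmax' w (by linarith)
    have h3 : ‖deriv g w‖ * t ≤ ‖deriv g w‖ * (r - dist w z) := by gcongr; linarith
    have h4 : ‖deriv g w‖ * t ≤ (2 * A) * t := by
      have : A * (r - dist w0 z) = (2 * A) * t := by rw [ht]; ring
      linarith
    exact le_of_mul_le_mul_right h4 ht0
  have hsch : ∀ w, dist w w0 < t → dist (deriv g w) (deriv g w0) ≤ (4 * A) / t * dist w w0 := by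
    intro w hw
    refine Complex.dist_le_div_mul_dist_of_mapsTo_ball (f := deriv g) (c := w0) (R₁ := t)
      (R₂ := 4 * A) (hg'.mono ?_) ?_ hw
    · intro v hv
      exact hsub v (by linarith [hball v hv])
    · intro v hv
      have h1 := hbd v hv
      have h2 := norm_sub_le (deriv g v) (deriv g w0)
      rw [mem_closedBall_iff_norm]
      linarith
  have hlin : ∀ w ∈ Metric.closedBall w0 (t/8),
      ‖(g w - deriv g w0 * w) - (g w0 - deriv g w0 * w0)‖ ≤ A / 2 * ‖w - w0‖ := by
    intro w hw
    refine (convex_closedBall w0 (t/8)).norm_image_sub_le_of_norm_hasDerivWithin_le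
      (f := fun w => g w - deriv g w0 * w) (f' := fun w => deriv g w - deriv g w0) ?_ ?_
      (Metric.mem_closedBall_self (by positivity)) hw
    · intro v hv
      have hv' : dist v w0 ≤ t / 8 := hv
      have hvH : c < v.re := hsub v (by linarith [hball v (by linarith)])
      have h1 := ((hg v hvH).differentiableAt (hHo.mem_nhds hvH)).hasDerivAt
      have h2 := (hasDerivAt_id v).const_mul (deriv g w0)
      have h3 := h1.sub h2
      rw [mul_one] at h3
      exact h3.hasDerivWithinAt
    · intro v hv
      have hv' : dist v w0 ≤ t / 8 := hv
      have h1 := hsch v (by linarith)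
      rw [dist_eq_norm] at h1
      refine h1.trans ?_
      calc 4 * A / t * dist v w0 ≤ 4 * A / t * (t / 8) := by gcongr
        _ = A / 2 := by field_simp; norm_num
  have hAt : A * t ≤ 64 * Real.pi := by
    by_contra! hcon
    have hDC : DiffContOnCl ℂ g (Metric.ball w0 (t/8)) := by
      apply DifferentiableOn.diffContOnCl
      refine hg.mono ?_
      intro v hv
      have hv' : dist v w0 ≤ t / 8 := Metric.closure_ball_subset_closedBall hv
      exact hsub v (by linarith [hball v (by linarith)])
    have hsph : ∀ v ∈ Metric.sphere w0 (t/8), A * t / 16 ≤ ‖g v - g w0‖ := by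
      intro v hv
      have h1 := hlin v (Metric.sphere_subset_closedBall hv)
      have h2 : ‖v - w0‖ = t / 8 := by simpa [dist_eq_norm] using hv
      have h3 : ‖deriv g w0 * (v - w0)‖ = A * (t / 8) := by rw [norm_mul, h2]
      have h4 : deriv g w0 * (v - w0) = (g v - g w0) -
        ((g v - deriv g w0 * v) - (g w0 - deriv g w0 * w0)) := by ring
      have h5 := norm_sub_le (g v - g w0) ((g v - deriv g w0 * v) - (g w0 - deriv g w0 * w0))
      rw [← h4, h3] at h5
      rw [h2] at h1
      linarith
    have hw0H : c < w0.re := hsub w0 hw0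
    have hnc : ∃ᶠ v in 𝓝 w0, g v ≠ g w0 := by
      intro hev
      have h1 : g =ᶠ[𝓝 w0] fun _ => g w0 := by
        filter_upwards [hev] with v hv using not_not.1 hv
      have h2 := h1.deriv_eq
      rw [deriv_const] at h2
      rw [hA, h2, norm_zero] at hA0
      exact lt_irrefl _ hA0
    have himg := hDC.ball_subset_image_closedBall (by positivity) hsph hnc
    have hmem : g w0 + 2 * Real.pi * Complex.I ∈ Metric.ball (g w0) (A * t / 16 / 2) := by
      rw [mem_ball_iff_norm]
      simp [abs_of_pos hpi]
      linarith
    obtain ⟨v, hv, hv2⟩ := himg hmem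
    have hv' : dist v w0 ≤ t / 8 := hv
    exact hd w0 v hw0H (hsub v (by linarith [hball v (by linarith)])) hv2
  have h1 : A * (r - dist w0 z) = 2 * (A * t) := by rw [ht]; ring
  have h2 : ‖deriv g z‖ * (z.re - c) = 2 * (‖deriv g z‖ * r) := by rw [hr]; ring
  rw [h2]
  linarith

/-- **Logarithmic coordinates setup.** There exist `D > 0` and `R₁ > 0` such
that for every `R ≥ R₁` and all `u, s ∈ ℤ`, with `Q` the square of side `R`
centered at `R`, both `g_s(Q)` and `g_u(g_s(Q))` have diameter less than `D`. -/
theorem diam_image_square_lt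
    (c : ℝ) (L : Set ℂ) (g F : ℂ → ℂ)
    (hL_ne : L.Nonempty) (hL_open : IsOpen L)
    (hL_sc : SimplyConnectedSpace L)
    (hLH : L ⊆ {z : ℂ | c < z.re})
    (hL_disj : ∀ k : ℤ, k ≠ 0 →
      Disjoint (closure L) ((fun z => z + 2 * Real.pi * k * Complex.I) '' closure L))
    (hL_cpt : ∀ M : ℝ, IsCompact (closure L ∩ {z : ℂ | z.re ≤ M}))
    (hg_cont : ContinuousOn g (closure {z : ℂ | c < z.re}))
    (hg_diff : DifferentiableOn ℂ g {z : ℂ | c < z.re})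
    (hg_bij : Set.BijOn g (closure {z : ℂ | c < z.re}) (closure L))
    (hg_im : g '' {z : ℂ | c < z.re} = L)
    (hFg : ∀ s : ℤ, ∀ z ∈ closure {z : ℂ | c < z.re},
      F (g z + 2 * Real.pi * s * Complex.I) = z)
    (hF_cont : ∀ s : ℤ, ContinuousOn F
      ((fun z => z + 2 * Real.pi * s * Complex.I) '' closure L))
    (hF_diff : ∀ s : ℤ, DifferentiableOn ℂ F
      ((fun z => z + 2 * Real.pi * s * Complex.I) '' L))
    :
    ∃ D : ℝ, 0 < D ∧ ∃ R₁ : ℝ, 0 < R₁ ∧ ∀ R : ℝ, R₁ ≤ R → ∀ u s : ℤ,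
      Metric.diam ((fun z => g z + 2 * Real.pi * s * Complex.I) ''
        {z : ℂ | z.re ∈ Set.Icc (R / 2) (3 * R / 2) ∧
          z.im ∈ Set.Icc (-(R / 2)) (R / 2)}) < D ∧
      Metric.diam ((fun z => g z + 2 * Real.pi * u * Complex.I) ''
        ((fun z => g z + 2 * Real.pi * s * Complex.I) ''
          {z : ℂ | z.re ∈ Set.Icc (R / 2) (3 * R / 2) ∧
            z.im ∈ Set.Icc (-(R / 2)) (R / 2)})) < D := by
  have hHo : IsOpen {z : ℂ | c < z.re} := isOpen_lt continuous_const Complex.continuous_re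
  have hpi := Real.pi_pos
  have hB : ∀ z : ℂ, c < z.re → ‖deriv g z‖ * (z.re - c) ≤ 256 * Real.pi := by
    refine bloch_aux g c hg_diff ?_
    intro z w hz hw heq
    have h1 := hg_bij.mapsTo (subset_closure hz)
    have h2 := hg_bij.mapsTo (subset_closure hw)
    refine Set.disjoint_left.1 (hL_disj 1 one_ne_zero) h2 ⟨g z, h1, ?_⟩
    simp [heq]
  -- Lipschitz on half-planes
  have hLip : ∀ δ : ℝ, 0 < δ → ∀ z w : ℂ, c + δ ≤ z.re → c + δ ≤ w.re →
      dist (g z) (g w) ≤ 256 * Real.pi / δ * dist z w := by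
    intro δ hδ z w hz hw
    rw [dist_eq_norm, dist_eq_norm]
    refine (convex_halfSpace_re_ge (c + δ)).norm_image_sub_le_of_norm_deriv_le ?_ ?_ hw hz
    · intro v hv
      have hv' : c + δ ≤ v.re := hv
      have hvH : c < v.re := by linarith
      exact (hg_diff v hvH).differentiableAt (hHo.mem_nhds hvH)
    · intro v hv
      have hv' : c + δ ≤ v.re := hv
      rw [le_div_iff₀ hδ]
      refine le_trans ?_ (hB v (by linarith))
      gcongr
      linarith
  -- real part large
  have hK : ∃ B : ℝ, ∀ z : ℂ, c < z.re → B < ‖z‖ → c + 1 ≤ (g z).re := by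
    have hFc : ContinuousOn F (closure L ∩ {z : ℂ | z.re ≤ c + 1}) := by
      refine (hF_cont 0).mono ?_
      intro z hz
      exact ⟨z, hz.1, by simp⟩
    obtain ⟨B, hBd⟩ := ((hL_cpt (c + 1)).image_of_continuousOn hFc).isBounded.exists_norm_le
    refine ⟨B, fun z hz hzB => ?_⟩
    by_contra! hlt
    have h1 := hFg 0 z (subset_closure hz)
    simp only [Int.cast_zero, mul_zero, zero_mul, add_zero] at h1
    have h2 := hBd z ⟨g z, ⟨hg_bij.mapsTo (subset_closure hz), hlt.le⟩, h1⟩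
    linarith
  obtain ⟨B, hBK⟩ := hK
  set E := 256 * Real.pi * 8 with hE
  have hE0 : 0 < E := by positivity
  have hD1 : 0 ≤ 256 * Real.pi * E := by positivity
  refine ⟨E + 256 * Real.pi * E + 1, by linarith, 4 * |c| + 2 * |B| + 1, by positivity, ?_⟩
  intro R hR u s
  have hc1 := abs_nonneg c
  have hc2 := le_abs_self c
  have hB1 := abs_nonneg B
  have hB2 := le_abs_self B
  have hR0 : 0 < R := by linarith
  have key : ∀ z : ℂ, z.re ∈ Set.Icc (R / 2) (3 * R / 2) → c + R / 4 ≤ z.re := by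
    intro z hz
    linarith [hz.1]
  have h1 : ∀ z w : ℂ, z.re ∈ Set.Icc (R / 2) (3 * R / 2) ∧ z.im ∈ Set.Icc (-(R / 2)) (R / 2) →
      w.re ∈ Set.Icc (R / 2) (3 * R / 2) ∧ w.im ∈ Set.Icc (-(R / 2)) (R / 2) →
      dist (g z) (g w) ≤ E := by
    intro z w hz hw
    refine (hLip (R / 4) (by positivity) z w (key z hz.1) (key w hw.1)).trans ?_
    have hd : dist z w ≤ 2 * R := by
      rw [dist_eq_norm]
      refine (Complex.norm_le_abs_re_add_abs_im _).trans ?_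
      have e1 : |(z - w).re| ≤ R := by
        rw [Complex.sub_re, abs_le]
        constructor <;> linarith [hz.1.1, hz.1.2, hw.1.1, hw.1.2]
      have e2 : |(z - w).im| ≤ R := by
        rw [Complex.sub_im, abs_le]
        constructor <;> linarith [hz.2.1, hz.2.2, hw.2.1, hw.2.2]
      linarith
    calc 256 * Real.pi / (R / 4) * dist z w ≤ 256 * Real.pi / (R / 4) * (2 * R) := by gcongr
      _ = E := by rw [hE]; field_simp; norm_num
  have h2 : ∀ z : ℂ, z.re ∈ Set.Icc (R / 2) (3 * R / 2) → c + 1 ≤ (g z).re := by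
    intro z hz
    refine hBK z (by linarith [key z hz]) ?_
    have := Complex.re_le_norm z
    linarith [hz.1]
  have h3 : ∀ z : ℂ, (z + 2 * Real.pi * s * Complex.I).re = z.re := by
    intro z
    simp
  constructor
  · refine lt_of_le_of_lt (Metric.diam_le_of_forall_dist_le hE0.le ?_) (by linarith)
    rintro _ ⟨z, hz, rfl⟩ _ ⟨w, hw, rfl⟩
    simp only [dist_add_right]
    exact h1 z w hz hw
  · refine lt_of_le_of_lt (Metric.diam_le_of_forall_dist_le hD1 ?_) (by linarith)
    rintro _ ⟨_, ⟨z, hz, rfl⟩, rfl⟩ _ ⟨_, ⟨w, hw, rfl⟩, rfl⟩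
    simp only [dist_add_right]
    refine (hLip 1 one_pos _ _ ?_ ?_).trans ?_
    · rw [h3]; exact h2 z hz.1
    · rw [h3]; exact h2 w hw.1
    · rw [dist_add_right, div_one]
      gcongr
      exact h1 z w hz hw
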